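/- Let X be a real Hilbert space with X = X⁻ ⊕ X⁺, X⁻ ⊥ X⁺, and let φ ∈ C¹(X,ℝ) be of the form φ(u) = ½(‖u⁺‖² − ‖u⁻‖²) − ψ(u) for u = u⁻ + u⁺ ∈ X⁻ ⊕ X⁺. Suppose (KS1): ψ ∈ C¹(X,ℝ) is bounded from below and weakly sequentially lower semi-continuous; (KS2): ψ′ is weakly sequentially continuous; (KS3): there exist r > ρ > 0 and e ∈ X⁺ with ‖e‖ = 1 such that κ := inf φ(S⁺_ρ) > sup φ(∂Q), where S⁺_ρ = {u ∈ X⁺ : ‖u‖ = ρ} and Q = {v + se : v ∈ X⁻, s ≥ 0, ‖v+se‖ ≤ r}. Then there exist a constant c ∈ [κ, sup φ(Q)] and a sequence {u_n} ⊂ X satisfying φ(u_n) → c and ‖φ′(u_n)‖(1 + ‖u_n‖) → 0. -/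

import Mathlib

open MeasureTheory Filter Topology RealInnerProductSpace

theorem det_id_add_eq_sum_lagrange {E : Type*} [NormedAddCommGroup E] [NormedSpace ℝ E]
    [FiniteDimensional ℝ E] (s : Finset ℝ) (hs : Module.finrank ℝ E < s.card) (A : E →L[ℝ] E) :
    (ContinuousLinearMap.id ℝ E + A).det =
      ∑ t ∈ s, (ContinuousLinearMap.id ℝ E + t • A).det * (Lagrange.basis s id t).eval 1 := by
  classical
  let b := Module.finBasis ℝ E
  let M := LinearMap.toMatrix b b (A : E →ₗ[ℝ] E)
  let p : Polynomial ℝ := Matrix.det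
    ((Polynomial.X : Polynomial ℝ) • M.map Polynomial.C + (1 : Matrix _ _ ℝ).map Polynomial.C)
  have hp : ∀ t : ℝ, p.eval t = (ContinuousLinearMap.id ℝ E + t • A).det := by
    intro t
    have h1 : (ContinuousLinearMap.id ℝ E + t • A).det =
        LinearMap.det (LinearMap.id + t • (A : E →ₗ[ℝ] E)) := rfl
    rw [h1, ← LinearMap.det_toMatrix b, ← Polynomial.coe_evalRingHom, RingHom.map_det]
    congr 1
    ext i j
    by_cases hij : i = j <;>
      simp [M, hij, LinearMap.toMatrix_apply] <;> ring
  have hdeg : p.degree < s.card := by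
    refine lt_of_le_of_lt Polynomial.degree_le_natDegree ?_
    have := Polynomial.natDegree_det_X_add_C_le M 1
    rw [Fintype.card_fin] at this
    exact_mod_cast this.trans_lt hs
  have h := congrArg (Polynomial.eval 1)
    (Lagrange.eq_interpolate (s := s) (v := id) (Set.injOn_id _) hdeg)
  rw [Lagrange.interpolate_apply, Polynomial.eval_finsetSum, hp, one_smul] at h
  rw [h]
  refine Finset.sum_congr rfl fun t _ => ?_
  simp [hp]

theorem sum_eval_lagrange_basis (s : Finset ℝ) (hs : s.Nonempty) :
    ∑ t ∈ s, (Lagrange.basis s id t).eval 1 = 1 := by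
  have := congrArg (Polynomial.eval 1) (Lagrange.sum_basis (s := s) (v := (id : ℝ → ℝ))
    (Set.injOn_id _) hs)
  simpa [Polynomial.eval_finsetSum] using this

/-- A small multiple `x + t • (r x - x)` of a retraction onto the sphere maps the open unit ball
bijectively onto itself, with positive Jacobian. -/
theorem setIntegral_det_eq_measure_ball {E : Type*} [NormedAddCommGroup E] [InnerProductSpace ℝ E]
    [FiniteDimensional ℝ E] [MeasurableSpace E] [BorelSpace E]
    (r : E → E) (hr : ContDiff ℝ 1 r) (hr1 : ∀ x, ‖r x‖ = 1) (hrid : ∀ x, ‖x‖ = 1 → r x = x) :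
    ∃ δ > 0, ∀ t ∈ Set.Ioo (0 : ℝ) δ,
      ∫ x in Metric.ball (0 : E) 1,
        (ContinuousLinearMap.id ℝ E + t • (fderiv ℝ r x - ContinuousLinearMap.id ℝ E)).det =
      (volume : Measure E).real (Metric.ball (0 : E) 1) := by
  let D : E → E →L[ℝ] E := fun x => fderiv ℝ r x - ContinuousLinearMap.id ℝ E
  have hDc : Continuous D := (hr.continuous_fderiv one_ne_zero).sub continuous_const
  obtain ⟨L, hL⟩ := (isCompact_closedBall (0 : E) 1).exists_bound_of_continuousOn hDc.continuousOn
  have hL0 : 0 ≤ L := (norm_nonneg _).trans (hL 0 (by simp))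
  obtain ⟨η, hη, hdet⟩ := Metric.continuousAt_iff.1
    ((ContinuousLinearMap.continuous_det (𝕜 := ℝ) (E := E)).continuousAt
      (x := ContinuousLinearMap.id ℝ E)) 1 one_pos
  have hdet1 : (ContinuousLinearMap.id ℝ E).det = 1 := LinearMap.det_id
  refine ⟨min 1 (min 1 η / (L + 1)), by positivity, fun t ht => ?_⟩
  have ht0 := ht.1
  have ht1 : t < 1 := ht.2.trans_le (min_le_left _ _)
  have ht2 : t * (L + 1) < min 1 η := by
    rw [← lt_div_iff₀ (by positivity)]; exact ht.2.trans_le (min_le_right _ _)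
  have ht3 : t * L < 1 := by nlinarith [min_le_left 1 η]
  have ht4 : t * L < η := by nlinarith [min_le_right 1 η]
  let f : E → E := fun x => x + t • (r x - x)
  have hfC : ContDiff ℝ 1 f := by fun_prop
  have hfd : ∀ x, HasFDerivAt f (ContinuousLinearMap.id ℝ E + t • D x) x := fun x =>
    (hasFDerivAt_id x).add
      ((((hr.differentiable one_ne_zero) x).hasFDerivAt.sub (hasFDerivAt_id x)).const_smul t)
  have hpos : ∀ x ∈ Metric.closedBall (0 : E) 1,
      0 < (ContinuousLinearMap.id ℝ E + t • D x).det := by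
    intro x hx
    have h := @hdet (ContinuousLinearMap.id ℝ E + t • D x) (by
      rw [dist_eq_norm, add_sub_cancel_left, norm_smul, Real.norm_of_nonneg ht0.le]
      exact (mul_le_mul_of_nonneg_left (hL x hx) ht0.le).trans_lt ht4)
    rw [hdet1, Real.dist_eq, abs_lt] at h
    linarith
  have hinj : Set.InjOn f (Metric.closedBall (0 : E) 1) := by
    intro x hx y hy hxy
    have hlip : ‖(r y - y) - (r x - x)‖ ≤ L * ‖y - x‖ := by
      refine Convex.norm_image_sub_le_of_norm_hasFDerivWithin_le (f := fun z => r z - z) (f' := D)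
        (s := Metric.closedBall (0 : E) 1)
        (fun z _ => ?_) (fun z hz => hL z hz) (convex_closedBall _ _) hx hy
      exact (((hr.differentiable one_ne_zero) z).hasFDerivAt.sub
        (hasFDerivAt_id z)).hasFDerivWithinAt
    have h1 : y - x = -(t • ((r y - y) - (r x - x))) := by
      have h0 : (x + t • (r x - x)) - (y + t • (r y - y)) = 0 := sub_eq_zero.2 hxy
      calc y - x = -(t • ((r y - y) - (r x - x))) -
            ((x + t • (r x - x)) - (y + t • (r y - y))) := by module
        _ = _ := by rw [h0, sub_zero]
    have h2 : ‖y - x‖ ≤ t * (L * ‖y - x‖) := by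
      conv_lhs => rw [h1, norm_neg, norm_smul, Real.norm_of_nonneg ht0.le]
      exact mul_le_mul_of_nonneg_left hlip ht0.le
    have h3 : ‖y - x‖ = 0 := by nlinarith [norm_nonneg (y - x)]
    exact (sub_eq_zero.1 (norm_eq_zero.1 h3)).symm
  have hmaps : ∀ x, ‖x‖ < 1 → ‖f x‖ < 1 := by
    intro x hx
    have : f x = (1 - t) • x + t • r x := by simp only [f]; module
    rw [this]
    refine (norm_add_le _ _).trans_lt ?_
    rw [norm_smul, norm_smul, hr1, Real.norm_of_nonneg ht0.le, Real.norm_of_nonneg (by linarith)]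
    nlinarith
  have hsph : ∀ x, ‖x‖ = 1 → f x = x := fun x hx => by simp [f, hrid x hx]
  have himage : f '' Metric.ball (0 : E) 1 = Metric.ball (0 : E) 1 := by
    refine Set.Subset.antisymm ?_ ?_
    · rintro _ ⟨x, hx, rfl⟩
      simpa using hmaps x (by simpa using hx)
    · refine (convex_ball (0 : E) 1).isPreconnected.subset_of_closure_inter_subset ?_ ?_ ?_
      · rw [isOpen_iff_mem_nhds]
        rintro _ ⟨x, hx, rfl⟩
        have hs : HasStrictFDerivAt f (ContinuousLinearMap.id ℝ E + t • D x) x :=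
          hfC.contDiffAt.hasStrictFDerivAt' (hfd x) one_ne_zero
        have hs' : HasStrictFDerivAt f
          ((ContinuousLinearMap.toContinuousLinearEquivOfDetNeZero _
            (hpos x (Metric.ball_subset_closedBall hx)).ne' : E ≃L[ℝ] E) : E →L[ℝ] E) x := by
          simpa using hs
        rw [← hs'.map_nhds_eq_of_equiv]
        exact image_mem_map (Metric.isOpen_ball.mem_nhds hx)
      · exact ⟨f 0, by simpa using hmaps 0 (by simp), 0, by simp, rfl⟩
      · rintro y ⟨hy, hyb⟩
        have hcl : IsClosed (f '' Metric.closedBall (0 : E) 1) :=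
          ((isCompact_closedBall _ _).image hfC.continuous).isClosed
        obtain ⟨x, hx, rfl⟩ := closure_minimal
          (Set.image_mono Metric.ball_subset_closedBall) hcl hy
        refine ⟨x, ?_, rfl⟩
        rw [mem_closedBall_zero_iff] at hx
        rw [mem_ball_zero_iff] at hyb ⊢
        refine lt_of_le_of_ne hx fun h => ?_
        rw [hsph x h] at hyb
        exact hyb.ne h
  have hcv := integral_image_eq_integral_abs_det_fderiv_smul (volume : Measure E)
    (s := Metric.ball (0 : E) 1) (f := f) Metric.isOpen_ball.measurableSet
    (fun x _ => (hfd x).hasFDerivWithinAt) (hinj.mono Metric.ball_subset_closedBall)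
    (fun _ => (1 : ℝ))
  rw [himage] at hcv
  rw [setIntegral_const, smul_eq_mul, mul_one] at hcv
  rw [hcv]
  refine setIntegral_congr_fun Metric.isOpen_ball.measurableSet fun x hx => ?_
  simp only [smul_eq_mul, mul_one]
  exact (abs_of_pos (hpos x (Metric.ball_subset_closedBall hx))).symm

/-- There is no `C¹` retraction of a Euclidean space onto its unit sphere. -/
theorem not_exists_contDiff_retraction {E : Type*} [NormedAddCommGroup E] [InnerProductSpace ℝ E]
    [FiniteDimensional ℝ E]
    (r : E → E) (hr : ContDiff ℝ 1 r) (hr1 : ∀ x, ‖r x‖ = 1) (hrid : ∀ x, ‖x‖ = 1 → r x = x) :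
    False := by
  let _ : MeasurableSpace E := borel E
  have : BorelSpace E := ⟨rfl⟩
  obtain ⟨δ, hδ, hvol⟩ := setIntegral_det_eq_measure_ball r hr hr1 hrid
  obtain ⟨s, hsub, hcard⟩ := (Set.Ioo_infinite hδ).exists_subset_card_eq (Module.finrank ℝ E + 1)
  have hDc : Continuous fun x => fderiv ℝ r x - ContinuousLinearMap.id ℝ E :=
    (hr.continuous_fderiv one_ne_zero).sub continuous_const
  have hdet0 : ∀ x, (fderiv ℝ r x).det = 0 := by
    intro x
    by_contra h
    have hsurj := (ContinuousLinearMap.toContinuousLinearEquivOfDetNeZero _ h).surjective (r x)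
    obtain ⟨v, hv⟩ := hsurj
    have hv' : fderiv ℝ r x v = r x := by simpa using hv
    have hd := ((hr.differentiable one_ne_zero) x).hasFDerivAt
    have h1 := hd.inner ℝ hd
    have h2 : (fun y => ⟪r y, r y⟫) = fun _ => (1 : ℝ) := by
      funext y; rw [real_inner_self_eq_norm_sq, hr1]; norm_num
    rw [h2] at h1
    have h3 := congrArg (fun T => T v) (h1.unique (hasFDerivAt_const (1 : ℝ) x))
    simp [hv', hr1] at h3
  have hzero : ∫ x in Metric.ball (0 : E) 1, (fderiv ℝ r x).det = 0 := by simp [hdet0]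
  have hexp : ∀ x, (fderiv ℝ r x).det = ∑ t ∈ s,
      (ContinuousLinearMap.id ℝ E + t • (fderiv ℝ r x - ContinuousLinearMap.id ℝ E)).det *
        (Lagrange.basis s id t).eval 1 := by
    intro x
    rw [← det_id_add_eq_sum_lagrange s (by omega), add_sub_cancel]
  simp_rw [hexp] at hzero
  rw [integral_finsetSum] at hzero
  · simp_rw [integral_mul_const] at hzero
    rw [Finset.sum_congr rfl fun t ht => by rw [hvol t (hsub ht)], ← Finset.mul_sum,
      sum_eval_lagrange_basis s (Finset.card_pos.1 (by omega)), mul_one] at hzero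
    refine (ENNReal.toReal_pos (Metric.measure_ball_pos _ _ one_pos).ne' ?_).ne' hzero
    exact measure_ball_lt_top.ne
  · intro t _
    have hc : Continuous fun x => (ContinuousLinearMap.id ℝ E +
        t • (fderiv ℝ r x - ContinuousLinearMap.id ℝ E)).det * (Lagrange.basis s id t).eval 1 :=
      (ContinuousLinearMap.continuous_det.comp
        (continuous_const.add (hDc.const_smul t))).mul continuous_const
    exact (hc.continuousOn.integrableOn_compact (isCompact_closedBall (0 : E) 1)).mono_set
      Metric.ball_subset_closedBall

/-- **Brouwer's fixed point theorem** for bounded continuous self-maps of a Euclidean space. -/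
theorem exists_fixedPoint_of_continuous_bounded {E : Type*} [NormedAddCommGroup E]
    [InnerProductSpace ℝ E] [FiniteDimensional ℝ E] (G : E → E) (hG : Continuous G) (R : ℝ)
    (hR : ∀ x, ‖G x‖ ≤ R) : ∃ x, G x = x := by
  by_contra! hne
  have hR0 : 0 ≤ R := (norm_nonneg _).trans (hR 0)
  let H : E → E := fun x => max 0 (min 1 (R + 1 - ‖x‖)) • G x
  have hH : Continuous H := by fun_prop
  have hH0 : ∀ x, R + 1 ≤ ‖x‖ → H x = 0 := by
    intro x hx
    have h : min 1 (R + 1 - ‖x‖) ≤ 0 := (min_le_right _ _).trans (by linarith)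
    simp only [H, max_eq_left h, zero_smul]
  have hHne : ∀ x, x - H x ≠ 0 := by
    intro x hx
    rw [sub_eq_zero] at hx
    have h1 : ‖H x‖ ≤ R := by
      rw [norm_smul, Real.norm_of_nonneg (le_max_left _ _)]
      have : max 0 (min 1 (R + 1 - ‖x‖)) ≤ 1 := max_le zero_le_one (min_le_left _ _)
      nlinarith [hR x, norm_nonneg (G x)]
    rw [← hx] at h1
    have h2 : max 0 (min 1 (R + 1 - ‖x‖)) = 1 := by
      rw [min_eq_left (by linarith), max_eq_right zero_le_one]
    have h3 : H x = G x := by simp only [H, h2, one_smul]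
    exact hne x (h3.symm.trans hx.symm)
  let t : E → Set E := fun x => Metric.ball (H x) ‖x - H x‖ ∩ {y | R + 2 ≤ ‖x‖ → y = 0}
  obtain ⟨g, hg⟩ := exists_contMDiffMap_forall_mem_convex_of_local_const (n := 1)
    (modelWithCornersSelf ℝ E) (t := t)
    (fun x => by
      refine (convex_ball _ _).inter ?_
      intro y hy z hz a b _ _ _ hx
      rw [hy hx, hz hx]; simp)
    (fun x => by
      by_cases hx : ‖x‖ < R + 2
      · refine ⟨H x, ?_⟩
        have h1 : ∀ᶠ y in 𝓝 x, dist (H x) (H y) < ‖y - H y‖ :=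
          (continuous_const.dist hH).continuousAt.eventually_lt
            (continuous_id.sub hH).norm.continuousAt (by simpa using hHne x)
        filter_upwards [h1, continuous_norm.continuousAt.eventually_lt continuousAt_const hx]
          with y hy hy2
        exact ⟨hy, fun h => absurd hy2 (not_lt.2 h)⟩
      · refine ⟨0, ?_⟩
        filter_upwards [continuousAt_const.eventually_lt (continuous_norm.continuousAt (x := x))
          (show R + 1 < ‖x‖ by linarith)] with y hy
        refine ⟨?_, fun _ => rfl⟩
        rw [hH0 y hy.le, sub_zero, Metric.mem_ball, dist_self]
        linarith)
  have hgs : ContDiff ℝ 1 g := g.contMDiff.contDiff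
  let h : E → E := fun x => (R + 2) • x - g ((R + 2) • x)
  have hh : ContDiff ℝ 1 h := by fun_prop
  have hh0 : ∀ x, h x ≠ 0 := by
    intro x hx
    have h1 := (hg ((R + 2) • x)).1
    rw [← sub_eq_zero.1 hx, Metric.mem_ball, dist_eq_norm] at h1
    exact h1.ne rfl
  refine not_exists_contDiff_retraction (fun x => ‖h x‖⁻¹ • h x) ?_ ?_ ?_
  · exact ((hh.norm ℝ hh0).inv fun x => norm_ne_zero_iff.2 (hh0 x)).smul hh
  · intro x
    rw [norm_smul, norm_inv, norm_norm, inv_mul_cancel₀ (norm_ne_zero_iff.2 (hh0 x))]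
  · intro x hx
    have hn : ‖(R + 2) • x‖ = R + 2 := by
      rw [norm_smul, hx, mul_one, Real.norm_of_nonneg (by linarith)]
    have h1 : h x = (R + 2) • x := by
      simp only [h, (hg ((R + 2) • x)).2 hn.ge, sub_zero]
    simp only [h1, hn, smul_smul, inv_mul_cancel₀ (show R + 2 ≠ 0 by linarith), one_smul]

/-- Schauder projections: a compact set can be moved by at most `ε` into a finite-dimensional
subspace by a continuous map with bounded values. -/
theorem IsCompact.exists_finiteDimensional_approx {E : Type*} [NormedAddCommGroup E]
    [NormedSpace ℝ E] {C : Set E} (hC : IsCompact C) {ε : ℝ} (hε : 0 < ε) :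
    ∃ (F : Submodule ℝ E) (p : E → E) (R : ℝ), FiniteDimensional ℝ F ∧ ContinuousOn p C ∧
      ∀ y ∈ C, p y ∈ F ∧ ‖p y - y‖ ≤ ε ∧ ‖p y‖ ≤ R := by
  obtain ⟨s, -, hs⟩ := hC.elim_nhds_subcover (fun x => Metric.ball x ε)
    (fun x _ => Metric.ball_mem_nhds x hε)
  obtain ⟨M, hM⟩ := hC.isBounded.exists_norm_le
  let μ : E → E → ℝ := fun x y => max 0 (ε - ‖y - x‖)
  have hμ0 : ∀ x y, 0 ≤ μ x y := fun _ _ => le_max_left _ _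
  have hμc : ∀ x, Continuous (μ x) := fun x => by fun_prop
  have hpos : ∀ y ∈ C, 0 < ∑ x ∈ s, μ x y := by
    intro y hy
    obtain ⟨x, hx, hyx⟩ := Set.mem_iUnion₂.1 (hs hy)
    refine Finset.sum_pos' (fun x _ => hμ0 x y) ⟨x, hx, lt_max_of_lt_right ?_⟩
    rw [Metric.mem_ball, dist_eq_norm] at hyx
    linarith
  let p : E → E := fun y => (∑ x ∈ s, μ x y)⁻¹ • ∑ x ∈ s, μ x y • x
  have hp : ∀ y ∈ C, ‖p y - y‖ ≤ ε := by
    intro y hy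
    have h1 : p y - y = (∑ x ∈ s, μ x y)⁻¹ • ∑ x ∈ s, μ x y • (x - y) := by
      simp only [p, smul_sub, Finset.sum_sub_distrib, ← Finset.sum_smul]
      rw [smul_smul (_⁻¹), inv_mul_cancel₀ (hpos y hy).ne', one_smul]
    rw [h1, norm_smul, norm_inv, Real.norm_of_nonneg (hpos y hy).le, inv_mul_le_iff₀ (hpos y hy),
      Finset.sum_mul]
    refine (norm_sum_le _ _).trans (Finset.sum_le_sum fun x _ => ?_)
    rw [norm_smul, Real.norm_of_nonneg (hμ0 x y)]
    by_cases hxy : ‖y - x‖ ≤ ε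
    · rw [norm_sub_rev]
      exact mul_le_mul_of_nonneg_left hxy (hμ0 x y)
    · have : μ x y = 0 := max_eq_left (by linarith)
      simp [this]
  refine ⟨Submodule.span ℝ (s : Set E), p, M + ε, FiniteDimensional.span_finset ℝ s, ?_,
    fun y hy => ⟨?_, hp y hy, ?_⟩⟩
  · refine ContinuousOn.smul (ContinuousOn.inv₀ ?_ fun y hy => (hpos y hy).ne') ?_
    · exact (continuous_finsetSum _ fun x _ => hμc x).continuousOn
    · exact (continuous_finsetSum _ fun x _ => (hμc x).smul continuous_const).continuousOn
  · exact Submodule.smul_mem _ _ (Submodule.sum_mem _ fun x hx =>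
      Submodule.smul_mem _ _ (Submodule.subset_span hx))
  · have := norm_sub_norm_le (p y) y
    linarith [hp y hy, hM y hy]

/-- **Schauder's fixed point theorem** for continuous maps with relatively compact range. -/
theorem exists_fixedPoint_of_continuous_compact_range {E : Type*} [NormedAddCommGroup E]
    [InnerProductSpace ℝ E] (G : E → E) (hG : Continuous G) {C : Set E} (hC : IsCompact C)
    (hGC : ∀ x, G x ∈ C) : ∃ x, G x = x := by
  have key : ∀ n : ℕ, ∃ x, ‖x - G x‖ ≤ 1 / ((n : ℝ) + 1) := by
    intro n
    obtain ⟨F, p, R, hF, hp, hpC⟩ := hC.exists_finiteDimensional_approx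
      (show 0 < 1 / ((n : ℝ) + 1) by positivity)
    obtain ⟨x, hx⟩ := exists_fixedPoint_of_continuous_bounded
      (fun x : F => (⟨p (G x), (hpC _ (hGC x)).1⟩ : F))
      ((hp.comp_continuous (hG.comp continuous_subtype_val) fun x => hGC _).subtype_mk _) R
      (fun x => (hpC _ (hGC x)).2.2)
    refine ⟨x, ?_⟩
    have h1 : p (G x) = x := congrArg Subtype.val hx
    have h2 := (hpC _ (hGC x)).2.1
    rwa [h1] at h2
  choose x hx using key
  obtain ⟨y, _, φ, hφ, hy⟩ := hC.tendsto_subseq fun n => hGC (x n)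
  have hxy : Tendsto (fun n => x (φ n)) atTop (𝓝 y) := by
    have h0 : Tendsto (fun n => x (φ n) - G (x (φ n))) atTop (𝓝 0) :=
      squeeze_zero_norm (fun n => hx (φ n))
        (tendsto_one_div_add_atTop_nhds_zero_nat.comp hφ.tendsto_atTop)
    simpa using h0.add hy
  exact ⟨y, tendsto_nhds_unique ((hG.tendsto y).comp hxy) hy⟩

/-- For bounded sequences, weak convergence to zero may be tested on a total family. -/
theorem tendsto_inner_zero_of_mem_closure_span {X : Type*} [NormedAddCommGroup X]
    [InnerProductSpace ℝ X] {d : ℕ → X} {R : ℝ} (hR : ∀ n, ‖d n‖ ≤ R) {S : Set X}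
    (hS : ∀ v ∈ S, Tendsto (fun n => ⟪d n, v⟫) atTop (𝓝 0)) {v : X}
    (hv : v ∈ closure (Submodule.span ℝ S : Set X)) :
    Tendsto (fun n => ⟪d n, v⟫) atTop (𝓝 0) := by
  have hspan : ∀ w ∈ Submodule.span ℝ S, Tendsto (fun n => ⟪d n, w⟫) atTop (𝓝 0) := by
    intro w hw
    induction hw using Submodule.span_induction with
    | mem x hx => exact hS x hx
    | zero => simp
    | add x y _ _ hx hy => simpa [inner_add_right] using hx.add hy
    | smul a x _ hx => simpa [inner_smul_right] using hx.const_mul a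
  have hR0 : 0 ≤ R := (norm_nonneg _).trans (hR 0)
  rw [Metric.tendsto_atTop]
  intro ε hε
  obtain ⟨w, hw, hvw⟩ := Metric.mem_closure_iff.1 hv (ε / (2 * (R + 1))) (by positivity)
  obtain ⟨N, hN⟩ := Metric.tendsto_atTop.1 (hspan w hw) (ε / 2) (by positivity)
  refine ⟨N, fun n hn => ?_⟩
  have h1 := hN n hn
  rw [dist_zero_right] at h1 ⊢
  have h2 : ⟪d n, v⟫ = ⟪d n, w⟫ + ⟪d n, v - w⟫ := by rw [inner_sub_right]; ring
  have h3 : ‖⟪d n, v - w⟫‖ ≤ (R + 1) * (ε / (2 * (R + 1))) := by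
    refine (norm_inner_le_norm _ _).trans ?_
    rw [dist_eq_norm] at hvw
    exact mul_le_mul (by linarith [hR n]) hvw.le (norm_nonneg _) (by positivity)
  have h4 : (R + 1) * (ε / (2 * (R + 1))) = ε / 2 := by field_simp
  rw [h2]
  linarith [norm_add_le ⟪d n, w⟫ ⟪d n, v - w⟫]

/-- Bounded sets of a Hilbert space are Fréchet–Urysohn for the weak topology, stated for a
weakly continuous bounded map `h` on a topological space. -/
theorem exists_seq_tendsto_inner_of_mem_closure {Z X : Type*} [TopologicalSpace Z]
    [NormedAddCommGroup X] [InnerProductSpace ℝ X] [CompleteSpace X] {h : Z → X}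
    (hh : ∀ v, Continuous fun z => ⟪h z, v⟫) {R : ℝ} (hR : ∀ z, ‖h z‖ ≤ R) {A : Set Z} {z₀ : Z}
    (hz₀ : z₀ ∈ closure A) :
    ∃ z : ℕ → Z, (∀ n, z n ∈ A) ∧ ∀ v, Tendsto (fun n => ⟪h (z n), v⟫) atTop (𝓝 ⟪h z₀, v⟫) := by
  obtain ⟨f, hfA, hf⟩ := exists_seq_of_forall_finset_exists (α := ℕ × Z) (fun p => p.2 ∈ A)
    (fun p q => p.1 < q.1 ∧ |⟪h q.2 - h z₀, h p.2⟫| < 1 / ((q.1 : ℝ) + 1) ∧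
      |⟪h q.2 - h z₀, h z₀⟫| < 1 / ((q.1 : ℝ) + 1)) (by
    intro s _
    let N := s.sup Prod.fst + 1
    have hev : ∀ v, ∀ᶠ z in 𝓝 z₀, |⟪h z - h z₀, v⟫| < 1 / ((N : ℝ) + 1) := by
      intro v
      have hc : Continuous fun z => |⟪h z - h z₀, v⟫| := by
        simp_rw [inner_sub_left]
        exact ((hh v).sub continuous_const).abs
      exact hc.continuousAt.eventually_lt continuousAt_const (by simp; positivity)
    have hall : ∀ᶠ z in 𝓝 z₀, (∀ p ∈ s, |⟪h z - h z₀, h p.2⟫| < 1 / ((N : ℝ) + 1)) ∧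
        |⟪h z - h z₀, h z₀⟫| < 1 / ((N : ℝ) + 1) :=
      ((Finset.eventually_all s).2 fun p _ => hev (h p.2)).and (hev (h z₀))
    obtain ⟨z, hz, hzA⟩ := (mem_closure_iff_frequently.1 hz₀).and_eventually hall |>.exists
    exact ⟨(N, z), hz, fun p hp =>
      ⟨Nat.lt_succ_of_le (Finset.le_sup (f := Prod.fst) hp), hzA.1 p hp, hzA.2⟩⟩)
  have hmono : StrictMono fun n => (f n).1 := fun m n hmn => (hf m n hmn).1
  have hlim : Tendsto (fun n => 1 / (((f n).1 : ℝ) + 1)) atTop (𝓝 0) :=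
    tendsto_one_div_add_atTop_nhds_zero_nat.comp hmono.tendsto_atTop
  let d : ℕ → X := fun n => h (f n).2 - h z₀
  have hd : ∀ n, ‖d n‖ ≤ R + R := fun n => (norm_sub_le _ _).trans (add_le_add (hR _) (hR _))
  let S : Set X := insert (h z₀) (Set.range fun n => h (f n).2)
  have hS : ∀ v ∈ S, Tendsto (fun n => ⟪d n, v⟫) atTop (𝓝 0) := by
    rintro v (rfl | ⟨m, rfl⟩)
    · refine squeeze_zero_norm' ?_ hlim
      filter_upwards [eventually_gt_atTop 0] with n hn
      exact (hf 0 n hn).2.2.le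
    · refine squeeze_zero_norm' ?_ hlim
      filter_upwards [eventually_gt_atTop m] with n hn
      exact (hf m n hn).2.1.le
  refine ⟨fun n => (f n).2, hfA, fun v => ?_⟩
  let K : Submodule ℝ X := (Submodule.span ℝ S).topologicalClosure
  have hdK : ∀ n, d n ∈ K := fun n => Submodule.le_topologicalClosure _
    (Submodule.sub_mem _ (Submodule.subset_span (Or.inr ⟨n, rfl⟩))
      (Submodule.subset_span (Or.inl rfl)))
  have : CompleteSpace K := (Submodule.isClosed_topologicalClosure _).completeSpace_coe
  have h1 : Tendsto (fun n => ⟪d n, K.starProjection v⟫) atTop (𝓝 0) := by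
    refine tendsto_inner_zero_of_mem_closure_span hd hS ?_
    rw [← Submodule.topologicalClosure_coe]
    exact K.starProjection_apply_mem v
  have h2 : ∀ n, ⟪h (f n).2, v⟫ = ⟪d n, K.starProjection v⟫ + ⟪h z₀, v⟫ := by
    intro n
    have := (K.mem_orthogonal _).1 (K.sub_starProjection_mem_orthogonal v) _ (hdK n)
    rw [inner_sub_right, sub_eq_zero] at this
    rw [← this, ← inner_add_left, sub_add_cancel]
  simp_rw [h2]
  simpa using h1.add_const ⟪h z₀, v⟫

theorem isClosed_preimage_of_weakSeqClosed {Z X : Type*} [TopologicalSpace Z]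
    [NormedAddCommGroup X] [InnerProductSpace ℝ X] [CompleteSpace X] {h : Z → X}
    (hh : ∀ v, Continuous fun z => ⟪h z, v⟫) {R : ℝ} (hR : ∀ z, ‖h z‖ ≤ R) {P : Set X}
    (hP : ∀ (u : ℕ → X) (u₀ : X), (∀ v, Tendsto (fun n => ⟪u n, v⟫) atTop (𝓝 ⟪u₀, v⟫)) →
      (∀ n, u n ∈ P) → u₀ ∈ P) : IsClosed (h ⁻¹' P) := by
  refine isClosed_of_closure_subset fun z₀ hz₀ => ?_
  obtain ⟨z, hzP, hz⟩ := exists_seq_tendsto_inner_of_mem_closure hh hR hz₀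
  exact hP _ _ hz hzP

theorem continuous_comp_of_weakSeqContinuous {Z X : Type*} [TopologicalSpace Z]
    [NormedAddCommGroup X] [InnerProductSpace ℝ X] [CompleteSpace X] {h : Z → X}
    (hh : ∀ v, Continuous fun z => ⟪h z, v⟫) {R : ℝ} (hR : ∀ z, ‖h z‖ ≤ R) {f : X → ℝ}
    (hf : ∀ (u : ℕ → X) (u₀ : X), (∀ v, Tendsto (fun n => ⟪u n, v⟫) atTop (𝓝 ⟪u₀, v⟫)) →
      Tendsto (fun n => f (u n)) atTop (𝓝 (f u₀))) : Continuous fun z => f (h z) := by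
  refine continuous_iff_isClosed.2 fun C hC => ?_
  exact isClosed_preimage_of_weakSeqClosed (P := f ⁻¹' C) hh hR fun u u₀ hu hmem =>
    hC.mem_of_tendsto (hf u u₀ hu) (Eventually.of_forall hmem)

theorem norm_le_of_tendsto_inner {X : Type*} [NormedAddCommGroup X] [InnerProductSpace ℝ X]
    {u : ℕ → X} {u₀ : X} (hu : ∀ v, Tendsto (fun n => ⟪u n, v⟫) atTop (𝓝 ⟪u₀, v⟫)) {b : ℝ}
    (hb : ∀ n, ‖u n‖ ≤ b) : ‖u₀‖ ≤ b := by
  have h1 : ⟪u₀, u₀⟫ ≤ b * ‖u₀‖ := le_of_tendsto (hu u₀) (Eventually.of_forall fun n =>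
    (real_inner_le_norm _ _).trans (mul_le_mul_of_nonneg_right (hb n) (norm_nonneg _)))
  rw [real_inner_self_eq_norm_mul_norm] at h1
  have hb0 : 0 ≤ b := (norm_nonneg _).trans (hb 0)
  by_contra! hlt
  nlinarith [norm_nonneg u₀]

/-- The intersection of a closed ball with a closed cone is weakly compact: it is the image of a
compact Hausdorff space under a weakly continuous map with norm-continuous inverse. -/
theorem exists_compact_weak_parametrization.{u} {X : Type u} [NormedAddCommGroup X]
    [InnerProductSpace ℝ X] [CompleteSpace X] (A : Set X) (r : ℝ) :
    ∃ (T : Type u) (_ : TopologicalSpace T) (_ : CompactSpace T) (_ : T2Space T) (ι : T → X)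
      (j : {u : X // ‖u‖ ≤ r ∧ ∀ a ∈ A, 0 ≤ ⟪u, a⟫} → T),
      (∀ τ, ‖ι τ‖ ≤ r ∧ ∀ a ∈ A, 0 ≤ ⟪ι τ, a⟫) ∧ (∀ v, Continuous fun τ => ⟪ι τ, v⟫) ∧
      Continuous j ∧ ∀ u, ι (j u) = u := by
  let B : Set (WeakDual ℝ X) :=
    WeakDual.toStrongDual ⁻¹' Metric.closedBall (0 : StrongDual ℝ X) r ∩ {f | ∀ a ∈ A, 0 ≤ f a}
  have hB : IsCompact B := by
    refine (WeakDual.isCompact_closedBall (𝕜 := ℝ) (0 : StrongDual ℝ X) r).inter_right ?_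
    simp only [Set.ofPred_forall]
    exact isClosed_biInter fun a _ => isClosed_le continuous_const (WeakDual.eval_continuous a)
  have : CompactSpace B := isCompact_iff_compactSpace.1 hB
  let ι : B → X := fun f => (InnerProductSpace.toDual ℝ X).symm (WeakDual.toStrongDual f.1)
  have hι : ∀ (f : B) v, ⟪ι f, v⟫ = f.1 v := fun f v =>
    InnerProductSpace.toDual_symm_apply
  refine ⟨B, inferInstance, inferInstance, inferInstance, ι, fun u =>
    ⟨StrongDual.toWeakDual (InnerProductSpace.toDual ℝ X u.1), ?_, ?_⟩, ?_, ?_, ?_, ?_⟩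
  · simpa using u.2.1
  · intro a ha
    exact u.2.2 a ha
  · intro f
    refine ⟨?_, fun a ha => ?_⟩
    · rw [LinearIsometryEquiv.norm_map]
      simpa using f.2.1
    · rw [hι]; exact f.2.2 a ha
  · intro v
    simp_rw [hι]
    exact (WeakDual.eval_continuous v).comp continuous_subtype_val
  · refine Continuous.subtype_mk ?_ _
    exact NormedSpace.Dual.toWeakDual_continuous.comp
      ((InnerProductSpace.toDual ℝ X).continuous.comp continuous_subtype_val)
  · intro u
    exact (InnerProductSpace.toDual ℝ X).symm_apply_apply u.1

/-- An ordering principle of Brezis–Browder type. -/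
theorem exists_forall_le_imp_eq_of_seq_bounded {α : Type*} (S : α → α → Prop)
    (hrefl : ∀ a, S a a) (htrans : ∀ a b c, S a b → S b c → S a c) (Φ : α → ℝ)
    (hbdd : BddBelow (Set.range Φ)) (hmono : ∀ a b, S a b → Φ b ≤ Φ a)
    (hseq : ∀ a : ℕ → α, (∀ m n, m ≤ n → S (a m) (a n)) → ∃ b, ∀ n, S (a n) b) (a₀ : α) :
    ∃ a, S a₀ a ∧ ∀ b, S a b → Φ b = Φ a := by
  have hbs : ∀ a, BddBelow (Φ '' {b | S a b}) := fun a => hbdd.mono (Set.image_subset_range _ _)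
  have hstep : ∀ (n : ℕ) (a : α), ∃ b, S a b ∧ Φ b ≤ sInf (Φ '' {b | S a b}) + 1 / ((n : ℝ) + 1) := by
    intro n a
    obtain ⟨_, ⟨b, hb, rfl⟩, hlt⟩ := exists_lt_of_csInf_lt
      (s := Φ '' {b | S a b}) ⟨_, a, hrefl a, rfl⟩
      (lt_add_of_pos_right _ (show (0 : ℝ) < 1 / ((n : ℝ) + 1) by positivity))
    exact ⟨b, hb, hlt.le⟩
  choose g hgS hgΦ using hstep
  let s : ℕ → α := fun n => Nat.rec a₀ (fun k a => g k a) n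
  have hs : ∀ m n, m ≤ n → S (s m) (s n) := by
    intro m n hmn
    induction n, hmn using Nat.le_induction with
    | base => exact hrefl _
    | succ n _ ih => exact htrans _ _ _ ih (hgS n (s n))
  obtain ⟨a, ha⟩ := hseq s hs
  refine ⟨a, ha 0, fun b hb => le_antisymm (hmono a b hb) ?_⟩
  refine ge_of_tendsto' (x := atTop) (f := fun n : ℕ => Φ b + 1 / ((n : ℝ) + 1)) ?_ fun n => ?_
  · simpa using tendsto_one_div_add_atTop_nhds_zero_nat.const_add (Φ b)
  · have h1 : Φ a ≤ Φ (s (n + 1)) := hmono _ _ (ha (n + 1))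
    have h2 : Φ (s (n + 1)) ≤ _ := hgΦ n (s n)
    have h3 := csInf_le (hbs (s n)) ⟨b, htrans _ _ _ (ha n) hb, rfl⟩
    linarith

/-- Pseudo-gradient step: `φ ∘ h` can be decreased at a definite rate on a closed set where
`‖φ'‖ (1 + ‖·‖)` is bounded below, without increasing it elsewhere. -/
theorem exists_descent_direction {Z X : Type*} [TopologicalSpace Z] [CompactSpace Z] [T2Space Z]
    [NormedAddCommGroup X] [InnerProductSpace ℝ X] [CompleteSpace X] {φ : X → ℝ}
    {φ' : X → X →L[ℝ] ℝ} (hφ : ∀ u, HasFDerivAt φ (φ' u) u)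
    (hφw : ∀ (u : ℕ → X) (u₀ : X),
      (∀ v, Tendsto (fun n => ⟪u n, v⟫) atTop (𝓝 ⟪u₀, v⟫)) →
      ∀ v, Tendsto (fun n => φ' (u n) v) atTop (𝓝 (φ' u₀ v)))
    {h : Z → X} (hh : ∀ v, Continuous fun z => ⟪h z, v⟫) {R : ℝ} (hR : ∀ z, ‖h z‖ ≤ R)
    {M O : Set Z} (hM : IsClosed M) (hO : IsOpen O) (hMO : M ⊆ O) {ε : ℝ} (hε : 0 < ε)
    (hlarge : ∀ z ∈ M, 2 * ε < ‖φ' (h z)‖ * (1 + ‖h z‖)) :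
    ∃ V : C(Z, X), (∀ z ∉ O, V z = 0) ∧ (∀ z, ‖V z‖ ≤ 1 + ‖h z‖) ∧
      ∃ δ > 0, ∀ s ∈ Set.Icc 0 δ, (∀ z, φ (h z - s • V z) ≤ φ (h z)) ∧
        ∀ z ∈ M, φ (h z - s • V z) ≤ φ (h z) - ε * s := by
  have hdir : ∀ z, ∃ w : X, z ∈ M → ‖w‖ < 1 + ‖h z‖ ∧ 2 * ε < φ' (h z) w := by
    intro z
    by_cases hz : z ∈ M
    swap
    · exact ⟨0, fun h => absurd h hz⟩
    have hpos : 0 < 1 + ‖h z‖ := by positivity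
    have h1 : 2 * ε / (1 + ‖h z‖) < ‖φ' (h z)‖ := (div_lt_iff₀ hpos).2 (hlarge z hz)
    obtain ⟨x, hx1, hx2⟩ := (φ' (h z)).exists_lt_apply_of_lt_opNorm h1
    have hxs : ∃ y : X, ‖y‖ < 1 ∧ 2 * ε / (1 + ‖h z‖) < φ' (h z) y := by
      rcases lt_max_iff.1 (show _ < max _ _ from hx2) with h | h
      · exact ⟨x, hx1, h⟩
      · exact ⟨-x, by rwa [norm_neg], by rwa [map_neg]⟩
    obtain ⟨y, hy1, hy2⟩ := hxs
    refine ⟨(1 + ‖h z‖) • y, fun _ => ⟨?_, ?_⟩⟩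
    · rw [norm_smul, Real.norm_of_nonneg hpos.le]
      nlinarith
    · rw [map_smul, smul_eq_mul]
      linarith [(div_lt_iff₀ hpos).1 hy2]
  choose w hw using hdir
  have hcont : ∀ v, Continuous fun z => φ' (h z) v := fun v =>
    continuous_comp_of_weakSeqContinuous (f := fun u => φ' u v) hh hR fun u u₀ hu => hφw u u₀ hu v
  let U : Z → Set Z := fun y => O ∩ {z | ‖w y‖ < 1 + ‖h z‖} ∩ {z | 2 * ε < φ' (h z) (w y)}
  have hUo : ∀ y, IsOpen (U y) := by
    intro y
    refine (hO.inter ?_).inter (isOpen_lt continuous_const (hcont _))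
    have hcl : IsClosed (h ⁻¹' Metric.closedBall (0 : X) (‖w y‖ - 1)) :=
      isClosed_preimage_of_weakSeqClosed hh hR fun u u₀ hu hmem => by
        simp only [mem_closedBall_zero_iff] at hmem ⊢
        exact norm_le_of_tendsto_inner hu hmem
    convert hcl.isOpen_compl using 1
    ext z
    simp [sub_lt_iff_lt_add']
  obtain ⟨t, htM, ht⟩ := hM.isCompact.elim_nhds_subcover U fun z hz =>
    (hUo z).mem_nhds ⟨⟨hMO hz, (hw z hz).1⟩, (hw z hz).2⟩
  obtain ⟨f, hf⟩ := PartitionOfUnity.exists_isSubordinate_of_locallyFinite hM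
    (fun i : t => U i) (fun i => hUo i) (locallyFinite_of_finite _) (by
      intro z hz
      obtain ⟨i, hi, hzi⟩ := Set.mem_iUnion₂.1 (ht hz)
      exact Set.mem_iUnion.2 ⟨⟨i, hi⟩, hzi⟩)
  let V : C(Z, X) := ⟨fun z => ∑ i : t, f i z • w i, by fun_prop⟩
  have hV : ∀ z, V z = ∑ i : t, f i z • w i := fun _ => rfl
  have hχ1 : ∀ z, ∑ i : t, f i z ≤ 1 := fun z => by
    rw [← finsum_eq_sum_of_fintype]; exact f.sum_le_one z
  have hsupp : ∀ i z, f i z ≠ 0 → z ∈ tsupport (f i) := fun i z hz =>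
    subset_tsupport _ hz
  refine ⟨V, ?_, ?_, ?_⟩
  · intro z hz
    rw [hV]
    refine Finset.sum_eq_zero fun i _ => ?_
    by_contra hne
    have hfi : f i z ≠ 0 := fun h0 => hne (by rw [h0, zero_smul])
    exact hz (hf i (hsupp i z hfi)).1.1
  · intro z
    rw [hV]
    calc ‖∑ i : t, f i z • w i‖ ≤ ∑ i : t, f i z * (1 + ‖h z‖) := by
          refine (norm_sum_le _ _).trans (Finset.sum_le_sum fun i _ => ?_)
          rw [norm_smul, Real.norm_of_nonneg (f.nonneg i z)]
          by_cases h0 : f i z = 0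
          · simp [h0]
          · exact mul_le_mul_of_nonneg_left (hf i (hsupp i z h0)).1.2.le (f.nonneg i z)
      _ = (∑ i : t, f i z) * (1 + ‖h z‖) := by rw [Finset.sum_mul]
      _ ≤ 1 * (1 + ‖h z‖) := mul_le_mul_of_nonneg_right (hχ1 z) (by positivity)
      _ = _ := one_mul _
  · let c : ℝ → ℝ := fun θ => max 0 (min 1 θ)
    have hc : Continuous c := by fun_prop
    have hc01 : ∀ θ, ‖c θ‖ ≤ 1 := fun θ => by
      rw [Real.norm_of_nonneg (le_max_left _ _)]
      exact max_le zero_le_one (min_le_left _ _)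
    have hgc : ∀ i : t, Continuous fun p : ℝ × Z => φ' (h p.2 - c p.1 • V p.2) (w i) := by
      intro i
      refine continuous_comp_of_weakSeqContinuous (f := fun u => φ' u (w i))
        (h := fun p : ℝ × Z => h p.2 - c p.1 • V p.2) (R := R + ‖V‖) (fun v => ?_) (fun p => ?_)
        fun u u₀ hu => hφw u u₀ hu _
      · simp_rw [inner_sub_left]
        exact ((hh v).comp continuous_snd).sub (by fun_prop)
      · refine (norm_sub_le _ _).trans (add_le_add (hR _) ?_)
        rw [norm_smul]
        have := mul_le_mul (hc01 p.1) (V.norm_coe_le_norm p.2) (norm_nonneg _) zero_le_one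
        rwa [one_mul] at this
    have hev : ∀ᶠ θ in 𝓝 (0 : ℝ), ∀ i : t, ∀ z ∈ tsupport (f i),
        ε < φ' (h z - c θ • V z) (w i) := by
      refine eventually_all.2 fun i => ?_
      refine (isClosed_tsupport (f i)).isCompact.eventually_forall_of_forall_eventually
        fun z hz => ?_
      refine continuousAt_const.eventually_lt (hgc i).continuousAt ?_
      have h1 := (hf i hz).2
      have hc0 : c 0 = 0 := by simp [c]
      simp only [Set.mem_ofPred_eq] at h1
      simp only [hc0, zero_smul, sub_zero]
      linarith
    obtain ⟨η, hη, hball⟩ := Metric.eventually_nhds_iff.1 hev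
    have hmain : ∀ s ∈ Set.Icc 0 (min 1 (η / 2)), ∀ z,
        φ (h z - s • V z) ≤ φ (h z) - ε * (∑ i : t, f i z) * s := by
      intro s hs z
      have hder : ∀ θ : ℝ, HasDerivAt (fun θ : ℝ => φ (h z - θ • V z))
          (φ' (h z - θ • V z) (-V z)) θ := by
        intro θ
        have h1 : HasDerivAt (fun θ : ℝ => h z - θ • V z) (-V z) θ := by
          simpa using ((hasDerivAt_id θ).smul_const (V z)).const_sub (h z)
        exact (hφ _).comp_hasDerivAt θ h1
      have hle := (convex_Icc (0 : ℝ) s).image_sub_le_mul_sub_of_deriv_le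
        (f := fun θ : ℝ => φ (h z - θ • V z)) (C := -(ε * ∑ i : t, f i z))
        (fun θ _ => (hder θ).continuousAt.continuousWithinAt)
        (fun θ _ => (hder θ).differentiableAt.differentiableWithinAt) (by
          intro θ hθ
          rw [interior_Icc] at hθ
          have hθ1 : θ ≤ 1 := hθ.2.le.trans (hs.2.trans (min_le_left _ _))
          have hθη : θ < η := by
            linarith [hθ.2, hs.2, min_le_right 1 (η / 2)]
          have hcθ : c θ = θ := by
            simp only [c, min_eq_right hθ1, max_eq_right hθ.1.le]
          have hb := hball (y := θ) (by
            rw [dist_zero_right, Real.norm_of_nonneg hθ.1.le]; exact hθη)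
          rw [(hder θ).deriv, map_neg, neg_le_neg_iff, hV z, map_sum, Finset.mul_sum]
          refine Finset.sum_le_sum fun i _ => ?_
          rw [map_smul, smul_eq_mul, mul_comm]
          by_cases h0 : f i z = 0
          · simp [h0]
          · have := hb i z (hsupp i z h0)
            rw [hcθ, hV z] at this
            exact mul_le_mul_of_nonneg_left this.le (f.nonneg i z))
        0 (Set.left_mem_Icc.2 hs.1) s (Set.right_mem_Icc.2 hs.1) hs.1
      simp only [zero_smul, sub_zero] at hle
      linarith
    refine ⟨min 1 (η / 2), by positivity, fun s hs => ⟨fun z => ?_, fun z hz => ?_⟩⟩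
    · have h1 : 0 ≤ ε * (∑ i : t, f i z) * s :=
        mul_nonneg (mul_nonneg hε.le (Finset.sum_nonneg fun i _ => f.nonneg i z)) hs.1
      linarith [hmain s hs z]
    · have h1 : ∑ i : t, f i z = 1 := by
        rw [← finsum_eq_sum_of_fintype]; exact f.sum_eq_one hz
      have := hmain s hs z
      rwa [h1, mul_one] at this


/-- The sphere in `Xp` links with the half ball in `Xm ⊕ ℝ e`: a compact homotopy starting at the
inclusion and keeping the relative boundary away from the sphere ends up meeting the sphere. -/
theorem exists_mem_sphere_of_compact_homotopy {X T : Type*} [NormedAddCommGroup X]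
    [InnerProductSpace ℝ X] [TopologicalSpace T] [CompactSpace T]
    (Xm Xp : Submodule ℝ X) (hcompl : IsCompl Xm Xp)
    (Pm Pp : X →L[ℝ] X) (hPm : ∀ u, Pm u ∈ Xm) (hPp : ∀ u, Pp u ∈ Xp)
    (hPsum : ∀ u, Pm u + Pp u = u) (r ρ : ℝ) (hρ : 0 < ρ) (hρr : ρ < r) (e : X) (he : e ∈ Xp)
    (hen : ‖e‖ = 1) (horth : ∀ v ∈ Xm, ⟪v, e⟫ = 0)
    (Q : Set (Xm ⊔ Submodule.span ℝ {e} : Submodule ℝ X))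
    (hQ : Q = {w : ↥(Xm ⊔ Submodule.span ℝ {e}) | (∃ v ∈ Xm, ∃ s : ℝ, 0 ≤ s ∧ (w : X) = v + s • e) ∧ ‖(w : X)‖ ≤ r})
    (ι : T → X) (hι : ∀ v, Continuous fun τ => ⟪ι τ, v⟫)
    (j : Q → T) (hj : Continuous j) (hιj : ∀ w : Q, ι (j w) = (w : X))
    (K : T × unitInterval → X) (hK : Continuous K) (hK0 : ∀ τ, K (τ, 0) = 0)
    (hfr : ∀ (w : Q), (w : ↥(Xm ⊔ Submodule.span ℝ {e})) ∈ frontier Q → ∀ t,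
      ¬ ((w : X) + K (j w, t) ∈ Xp ∧ ‖(w : X) + K (j w, t)‖ = ρ)) :
    ∃ w : Q, (w : X) + K (j w, 1) ∈ Xp ∧ ‖(w : X) + K (j w, 1)‖ = ρ := by
  have hPme : ∀ u ∈ Xp, Pm u = 0 := by
    intro u hu
    have h1 : Pm u ∈ Xp := by
      rw [show Pm u = u - Pp u by rw [eq_sub_iff_add_eq, hPsum]]
      exact Xp.sub_mem hu (hPp u)
    exact (Submodule.disjoint_def.1 hcompl.disjoint) _ (hPm u) h1
  have hPpm : ∀ u ∈ Xm, Pp u = 0 := by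
    intro u hu
    have h1 : Pp u ∈ Xm := by
      rw [show Pp u = u - Pm u by rw [eq_sub_iff_add_eq', hPsum]]
      exact Xm.sub_mem hu (hPm u)
    exact (Submodule.disjoint_def.1 hcompl.disjoint) _ h1 (hPp u)
  have hPpp : ∀ u ∈ Xp, Pp u = u := fun u hu => by
    have := hPsum u; rwa [hPme u hu, zero_add] at this
  have hPmm : ∀ u ∈ Xm, Pm u = u := fun u hu => by
    have := hPsum u; rwa [hPpm u hu, add_zero] at this
  have hee : ⟪e, e⟫ = 1 := by rw [real_inner_self_eq_norm_sq, hen]; norm_num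
  have hdecomp : ∀ w : ↥(Xm ⊔ Submodule.span ℝ {e}), (w : X) = Pm w + ⟪(w : X), e⟫ • e := by
    intro w
    obtain ⟨v, hv, y, hy, hvy⟩ := Submodule.mem_sup.1 w.2
    obtain ⟨s, rfl⟩ := Submodule.mem_span_singleton.1 hy
    rw [← hvy, map_add, map_smul, hPmm v hv, hPme e he, inner_add_left, inner_smul_left,
      horth v hv, hee]
    simp
  have hQmem : ∀ w, w ∈ Q ↔ 0 ≤ ⟪(w : X), e⟫ ∧ ‖(w : X)‖ ≤ r := by
    intro w
    rw [hQ]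
    refine and_congr_left fun _ => ⟨?_, fun h => ⟨Pm w, hPm _, _, h, hdecomp w⟩⟩
    rintro ⟨v, hv, s, hs, hw⟩
    rw [hw, inner_add_left, inner_smul_left, horth v hv, hee]
    simpa using hs
  have hQcl : IsClosed Q := by
    have : Q = {w : ↥(Xm ⊔ Submodule.span ℝ {e}) | 0 ≤ ⟪(w : X), e⟫} ∩ {w | ‖(w : X)‖ ≤ r} := by
      ext w; exact hQmem w
    rw [this]
    exact (isClosed_le (by fun_prop) (by fun_prop)).inter (isClosed_le (by fun_prop) (by fun_prop))
  -- a point `x` lies on the sphere iff `Pm x + ‖Pp x‖ e = ρ e`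
  have hsphere : ∀ x : X, Pm x + ‖Pp x‖ • e = ρ • e ↔ x ∈ Xp ∧ ‖x‖ = ρ := by
    intro x
    constructor
    · intro h
      have h1 : Pm x = (ρ - ‖Pp x‖) • e := by rw [sub_smul, ← h, add_sub_cancel_right]
      have h2 : Pm x = 0 := (Submodule.disjoint_def.1 hcompl.disjoint) _ (hPm x)
        (h1 ▸ Xp.smul_mem _ he)
      have h3 : Pp x = x := by have := hPsum x; rwa [h2, zero_add] at this
      refine ⟨h3 ▸ hPp x, ?_⟩
      rw [h2, h3, zero_add] at h
      have := congrArg norm h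
      simpa [norm_smul, hen, abs_of_pos hρ] using this
    · rintro ⟨hx, hn⟩
      rw [hPme x hx, hPpp x hx, hn, zero_add]
  let a : T × unitInterval → X := fun p => ⟪ι p.1, e⟫ • e + Pp (K p)
  let G₀ : T × unitInterval → ↥(Xm ⊔ Submodule.span ℝ {e}) := fun p =>
    ⟨-Pm (K p) + (⟪ι p.1, e⟫ - ‖a p‖ + ρ) • e,
      Submodule.add_mem_sup (Xm.neg_mem (hPm _))
        (Submodule.smul_mem _ _ (Submodule.mem_span_singleton_self e))⟩
  have hιc : Continuous fun p : T × unitInterval => ⟪ι p.1, e⟫ := (hι e).comp continuous_fst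
  have ha : Continuous a := (hιc.smul continuous_const).add (Pp.continuous.comp hK)
  have hG₀ : Continuous G₀ := by
    refine Continuous.subtype_mk ?_ _
    exact (Pm.continuous.comp hK).neg.add
      (((hιc.sub ha.norm).add continuous_const).smul continuous_const)
  have hG₀fix : ∀ (w : Q) t, G₀ (j w, t) = w ↔
      (w : X) + K (j w, t) ∈ Xp ∧ ‖(w : X) + K (j w, t)‖ = ρ := by
    intro w t
    rw [← hsphere, Subtype.ext_iff]
    have h1 : Pm ((w : X) + K (j w, t)) = Pm w + Pm (K (j w, t)) := map_add _ _ _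
    have h2 : Pp ((w : X) + K (j w, t)) = a (j w, t) := by
      have h3 : Pp (w : X) = ⟪(w : X), e⟫ • e := by
        conv_lhs => rw [hdecomp w.1]
        rw [map_add, map_smul, hPpp e he, hPpm _ (hPm _), zero_add]
      simp only [a, hιj, map_add, h3]
    rw [h1, h2]
    simp only [G₀, hιj]
    have h4 := hdecomp w.1
    have key : ∀ (x : X) (b : ℝ),
        -x + (⟪(w : X), e⟫ - b + ρ) • e - (w : X) = ρ • e - (Pm (w : X) + x + b • e) := by
      intro x b
      calc _ = -x + (⟪(w : X), e⟫ - b + ρ) • e - (Pm (w : X) + ⟪(w : X), e⟫ • e) := by rw [← h4]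
        _ = _ := by module
    rw [← sub_eq_zero, key, sub_eq_zero, eq_comm]
  let p₀ : ↥(Xm ⊔ Submodule.span ℝ {e}) := ⟨ρ • e, Submodule.mem_sup_right
    (Submodule.smul_mem _ _ (Submodule.mem_span_singleton_self e))⟩
  have hp₀Q : p₀ ∈ Q := by
    rw [hQmem]
    simp only [p₀, inner_smul_left, hee, norm_smul, hen]
    simp [abs_of_pos hρ, hρ.le, hρr.le]
  have hG₀0 : ∀ w : Q, G₀ (j w, 0) = p₀ := by
    intro w
    refine Subtype.ext ?_
    have hs := ((hQmem w.1).1 w.2).1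
    simp only [G₀, a, p₀, hK0, hιj, map_zero, neg_zero, zero_add, add_zero, norm_smul, hen,
      mul_one, Real.norm_of_nonneg hs, sub_self]
  -- the points of `Q` that are fixed at some time
  let Z₀ : Set ↥(Xm ⊔ Submodule.span ℝ {e}) :=
    Subtype.val '' (Prod.fst '' {q : Q × unitInterval | G₀ (j q.1, q.2) = q.1})
  have hZ₀ : IsClosed Z₀ := by
    refine hQcl.isClosedEmbedding_subtypeVal.isClosedMap _
      (isClosedMap_fst_of_compactSpace _ ?_)
    exact isClosed_eq (hG₀.comp ((hj.comp continuous_fst).prodMk continuous_snd))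
      (continuous_subtype_val.comp continuous_fst)
  have hdisj : Disjoint (frontier Q) Z₀ := by
    rw [Set.disjoint_left]
    rintro _ hw ⟨w, ⟨q, hq, rfl⟩, rfl⟩
    exact hfr q.1 hw q.2 ((hG₀fix _ _).1 hq)
  obtain ⟨f, hf0, hf1, hf01⟩ := exists_continuous_zero_one_of_isClosed isClosed_frontier hZ₀ hdisj
  let l : ↥(Xm ⊔ Submodule.span ℝ {e}) → unitInterval := fun w => ⟨f w, hf01 w⟩
  have hl : Continuous l := f.continuous.subtype_mk _
  classical
  let G : ↥(Xm ⊔ Submodule.span ℝ {e}) → ↥(Xm ⊔ Submodule.span ℝ {e}) := fun w =>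
    if hw : w ∈ Q then G₀ (j ⟨w, hw⟩, l w) else p₀
  have hGQ : ∀ w (hw : w ∈ Q), G w = G₀ (j ⟨w, hw⟩, l w) := fun w hw => dif_pos hw
  have hGQ' : ∀ w, w ∉ interior Q → G w = p₀ := by
    intro w hwi
    by_cases hw : w ∈ Q
    · have hwf : w ∈ frontier Q := by
        rw [hQcl.frontier_eq]; exact ⟨hw, hwi⟩
      have hl0 : l w = 0 := Subtype.ext (hf0 hwf)
      rw [hGQ w hw, hl0, hG₀0]
    · exact dif_neg hw
  have hGc : Continuous G := by
    have hon : ContinuousOn G Q := by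
      rw [continuousOn_iff_continuous_domRestrict]
      have : Q.domRestrict G = fun w : Q => G₀ (j w, l w) := by
        funext w; exact hGQ w.1 w.2
      rw [this]
      exact hG₀.comp (hj.prodMk (hl.comp continuous_subtype_val))
    have hon' : ContinuousOn G (interior Q)ᶜ :=
      continuousOn_const.congr fun w hw => hGQ' w hw
    rw [← continuousOn_univ]
    refine (hon.union_of_isClosed hon' hQcl isOpen_interior.isClosed_compl).mono fun w _ => ?_
    by_cases hw : w ∈ Q
    · exact Or.inl hw
    · exact Or.inr fun h => hw (interior_subset h)
  obtain ⟨w, hw⟩ := exists_fixedPoint_of_continuous_compact_range G hGc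
    ((isCompact_range hG₀).union (isCompact_singleton (x := p₀))) (fun w => by
      by_cases hw : w ∈ Q
      · rw [hGQ w hw]; exact Or.inl ⟨_, rfl⟩
      · exact Or.inr (dif_neg hw))
  have hwQ : w ∈ Q := by
    by_contra hwQ
    rw [hGQ' w fun h => hwQ (interior_subset h)] at hw
    exact hwQ (hw ▸ hp₀Q)
  rw [hGQ w hwQ] at hw
  have hwZ : w ∈ Z₀ := ⟨⟨w, hwQ⟩, ⟨(⟨w, hwQ⟩, l w), hw, rfl⟩, rfl⟩
  have hl1 : l w = 1 := Subtype.ext (hf1 hwZ)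
  rw [hl1] at hw
  exact ⟨⟨w, hwQ⟩, (hG₀fix ⟨w, hwQ⟩ 1).1 hw⟩

/-- A minimax level over a class of compact deformations contains almost critical points, with
Cerami's weight. -/
theorem exists_almost_critical_of_minimax {T X : Type*} [TopologicalSpace T] [CompactSpace T]
    [T2Space T] [Nonempty T] [NormedAddCommGroup X] [InnerProductSpace ℝ X] [CompleteSpace X]
    {φ : X → ℝ} {φ' : X → X →L[ℝ] ℝ} (hφ : ∀ u, HasFDerivAt φ (φ' u) u)
    (hφw : ∀ (u : ℕ → X) (u₀ : X),
      (∀ v, Tendsto (fun n => ⟪u n, v⟫) atTop (𝓝 ⟪u₀, v⟫)) →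
      ∀ v, Tendsto (fun n => φ' (u n) v) atTop (𝓝 (φ' u₀ v)))
    (hφb : ∀ R, BddAbove (φ '' Metric.closedBall 0 R))
    {ι : T → X} (hι : ∀ v, Continuous fun τ => ⟪ι τ, v⟫) {r : ℝ} (hιr : ∀ τ, ‖ι τ‖ ≤ r)
    (husc : ∀ (K : C(T × unitInterval, X)) (b : ℝ), IsClosed {z | b ≤ φ (ι z.1 + K z)})
    {B : Set T} {b κ : ℝ} {S : Set C(T × unitInterval, X)}
    (hS : ∀ K, K ∈ S ↔ (∀ τ, K (τ, 0) = 0) ∧ ∀ τ ∈ B, ∀ t, φ (ι τ + K (τ, t)) ≤ b)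
    (hSne : S.Nonempty) (hκ : ∀ K ∈ S, ∃ τ, κ ≤ φ (ι τ + K (τ, 1))) {ε : ℝ} (hε : 0 < ε) :
    ∃ u, |φ u - ⨅ K : S, ⨆ τ, φ (ι τ + K.1 (τ, 1))| ≤ ε ∧ ‖φ' u‖ * (1 + ‖u‖) ≤ 2 * ε := by
  have : Nonempty S := hSne.to_subtype
  have hφc : Continuous φ := continuous_iff_continuousAt.2 fun u => (hφ u).continuousAt
  let h : C(T × unitInterval, X) → T × unitInterval → X := fun K z => ι z.1 + K z
  let Φ : C(T × unitInterval, X) → ℝ := fun K => ⨆ τ, φ (h K (τ, 1))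
  let c : ℝ := ⨅ K : S, Φ K
  have hR : ∀ K z, ‖h K z‖ ≤ r + ‖K‖ := fun K z =>
    (norm_add_le _ _).trans (add_le_add (hιr _) (K.norm_coe_le_norm z))
  have hle : ∀ K τ, φ (h K (τ, 1)) ≤ Φ K := by
    intro K τ
    refine le_ciSup (f := fun τ => φ (h K (τ, 1))) ((hφb (r + ‖K‖)).mono ?_) τ
    rintro _ ⟨τ, rfl⟩
    exact ⟨_, mem_closedBall_zero_iff.2 (hR K _), rfl⟩
  have hκΦ : ∀ K ∈ S, κ ≤ Φ K := fun K hK => by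
    obtain ⟨τ, hτ⟩ := hκ K hK
    exact hτ.trans (hle K τ)
  have hbdd : BddBelow (Set.range fun K : S => Φ K) := ⟨κ, by
    rintro _ ⟨K, rfl⟩; exact hκΦ K K.2⟩
  have hhd : ∀ K L z, h L z - h K z = L z - K z := fun K L z => by simp [h]
  let rel : S → S → Prop := fun K L => Φ L ≤ Φ K ∧
    ∀ z, ‖L.1 z - K.1 z‖ ≤ (1 + ‖h K z‖) * (Real.exp ((Φ K - Φ L) / ε) - 1)
  have hgrow : ∀ K L, rel K L → ∀ z,
      1 + ‖h L z‖ ≤ (1 + ‖h K z‖) * Real.exp ((Φ K - Φ L) / ε) := by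
    intro K L hKL z
    have h1 := hKL.2 z
    rw [← hhd] at h1
    have h2 := norm_sub_norm_le (h L z) (h K z)
    linarith
  have htrans : ∀ K L N, rel K L → rel L N → rel K N := by
    intro K L N hKL hLN
    refine ⟨hLN.1.trans hKL.1, fun z => ?_⟩
    have h1 := hgrow K L hKL z
    have h2 := hLN.2 z
    have h3 := hKL.2 z
    have h4 : 1 ≤ Real.exp ((Φ L - Φ N) / ε) :=
      Real.one_le_exp (div_nonneg (sub_nonneg.2 hLN.1) hε.le)
    have h5 : Real.exp ((Φ K - Φ N) / ε) =
        Real.exp ((Φ K - Φ L) / ε) * Real.exp ((Φ L - Φ N) / ε) := by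
      rw [← Real.exp_add]; congr 1; ring
    have h6 : ‖N.1 z - K.1 z‖ ≤ ‖N.1 z - L.1 z‖ + ‖L.1 z - K.1 z‖ := by
      simpa using norm_add_le (N.1 z - L.1 z) (L.1 z - K.1 z)
    have h7 := mul_le_mul_of_nonneg_right h1 (sub_nonneg.2 h4)
    rw [h5]
    linarith
  have hseq : ∀ a : ℕ → S, (∀ m n, m ≤ n → rel (a m) (a n)) → ∃ L, ∀ n, rel (a n) L := by
    intro a ha
    have hanti : Antitone fun n => Φ (a n) := fun m n hmn => (ha m n hmn).1
    obtain ⟨ℓ, hℓ⟩ : ∃ ℓ, Tendsto (fun n => Φ (a n)) atTop (𝓝 ℓ) :=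
      ⟨_, tendsto_atTop_ciInf hanti (hbdd.mono (by rintro _ ⟨n, rfl⟩; exact ⟨a n, rfl⟩))⟩
    have hℓle : ∀ n, ℓ ≤ Φ (a n) := fun n => hanti.le_of_tendsto hℓ n
    let C : ℝ := (1 + (r + ‖(a 0).1‖)) * Real.exp ((Φ (a 0) - ℓ) / ε)
    have hr0 : 0 ≤ r := (norm_nonneg _).trans (hιr (Classical.arbitrary T))
    have hC0 : 0 ≤ C := by positivity
    have hC : ∀ n z, 1 + ‖h (a n) z‖ ≤ C := by
      intro n z
      refine (hgrow _ _ (ha 0 n (Nat.zero_le n)) z).trans ?_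
      refine mul_le_mul (by linarith [hR (a 0) z]) ?_ (Real.exp_pos _).le (by positivity)
      refine Real.exp_le_exp.2 ?_
      gcongr
      exact hℓle n
    let β : ℕ → ℝ := fun n => C * (Real.exp ((Φ (a n) - ℓ) / ε) - 1)
    have hβ0 : ∀ n, 0 ≤ β n := fun n => mul_nonneg hC0 (sub_nonneg.2
      (Real.one_le_exp (div_nonneg (sub_nonneg.2 (hℓle n)) hε.le)))
    have hdist : ∀ m n, m ≤ n → dist (a n).1 (a m).1 ≤ β m := by
      intro m n hmn
      refine (ContinuousMap.dist_le (hβ0 m)).2 fun z => ?_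
      rw [dist_eq_norm]
      refine ((ha m n hmn).2 z).trans ?_
      refine mul_le_mul (hC m z) ?_ (sub_nonneg.2
        (Real.one_le_exp (div_nonneg (sub_nonneg.2 (ha m n hmn).1) hε.le))) hC0
      refine sub_le_sub_right (Real.exp_le_exp.2 ?_) _
      gcongr
      exact hℓle n
    have hcau : CauchySeq fun n => (a n).1 := by
      refine cauchySeq_of_le_tendsto_0 (fun n => β n + β n) (fun n m N hn hm =>
        (dist_triangle_right _ _ (a N).1).trans (add_le_add (hdist N n hn) (hdist N m hm))) ?_
      have h1 : Tendsto β atTop (𝓝 (C * (Real.exp ((ℓ - ℓ) / ε) - 1))) :=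
        (((hℓ.sub_const ℓ).div_const ε).rexp.sub_const 1).const_mul C
      simpa using h1.add h1
    obtain ⟨L, hL⟩ := cauchySeq_tendsto_of_complete hcau
    have hLz : ∀ z, Tendsto (fun n => (a n).1 z) atTop (𝓝 (L z)) := fun z =>
      ((continuous_eval_const z).tendsto L).comp hL
    have hφL : ∀ z, Tendsto (fun n => φ (h (a n) z)) atTop (𝓝 (φ (h L z))) := fun z =>
      (hφc.tendsto _).comp ((hLz z).const_add (ι z.1))
    have hLS : L ∈ S := by
      refine (hS L).2 ⟨fun τ => ?_, fun τ hτ t => ?_⟩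
      · refine tendsto_nhds_unique (hLz (τ, 0)) ?_
        simp_rw [fun n => ((hS (a n)).1 (a n).2).1 τ]
        exact tendsto_const_nhds
      · exact le_of_tendsto (hφL (τ, t)) (Eventually.of_forall fun n =>
          ((hS (a n)).1 (a n).2).2 τ hτ t)
    have hΦL : ∀ n, Φ L ≤ Φ (a n) := fun n => ciSup_le fun τ =>
      le_of_tendsto (hφL (τ, 1)) ((eventually_ge_atTop n).mono fun k hk =>
        (hle (a k) τ).trans (hanti hk))
    refine ⟨⟨L, hLS⟩, fun n => ⟨hΦL n, fun z => ?_⟩⟩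
    refine le_of_tendsto ((hLz z).sub_const _).norm ((eventually_ge_atTop n).mono fun k hk => ?_)
    refine ((ha n k hk).2 z).trans ?_
    refine mul_le_mul_of_nonneg_left (sub_le_sub_right (Real.exp_le_exp.2 ?_) _) (by positivity)
    gcongr
    exact hΦL k
  obtain ⟨K₀, hK₀⟩ := exists_lt_of_ciInf_lt (show (⨅ K : S, Φ K) < c + ε by simp [c, hε])
  obtain ⟨K, hK₀K, hK⟩ := exists_forall_le_imp_eq_of_seq_bounded rel
    (fun K => ⟨le_rfl, fun z => by simp⟩) htrans (fun K => Φ K) hbdd (fun _ _ h => h.1) hseq K₀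
  have hcK : c ≤ Φ K := ciInf_le hbdd K
  have hKc : Φ K < c + ε := hK₀K.1.trans_lt hK₀
  by_contra! hcon
  have hcon' : ∀ u, c - ε ≤ φ u → φ u ≤ c + ε → 2 * ε < ‖φ' u‖ * (1 + ‖u‖) := fun u h1 h2 =>
    hcon u (abs_sub_le_iff.2 ⟨by change φ u - c ≤ ε; linarith, by change c - φ u ≤ ε; linarith⟩)
  obtain ⟨V, hV0, hV1, δ, hδ, hV⟩ := exists_descent_direction hφ hφw
    (h := h K) (R := r + ‖K.1‖) (fun v => by
      simp only [h, inner_add_left]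
      exact ((hι v).comp continuous_fst).add (by fun_prop)) (hR K)
    (M := {z | Φ K - ε ≤ φ (ι z.1 + K.1 z)} ∩ {z | z.2 = 1}) (O := {z | z.2 ≠ 0})
    ((husc K.1 _).inter (isClosed_eq continuous_snd continuous_const))
    (isOpen_ne_fun continuous_snd continuous_const)
    (fun z hz => by
      have : z.2 = 1 := hz.2
      simp [this]) hε (by
      rintro ⟨τ, t⟩ ⟨hz, ht⟩
      obtain rfl : t = 1 := ht
      have h1 : Φ K - ε ≤ φ (h K (τ, 1)) := hz
      exact hcon' _ (by linarith) (by linarith [hle K τ]))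
  let s := min δ 1
  have hs0 : 0 < s := lt_min hδ one_pos
  have hs1 : s ≤ 1 := min_le_right _ _
  obtain ⟨hVle, hVM⟩ := hV s ⟨hs0.le, min_le_left _ _⟩
  have hhs : ∀ z, h (K.1 - s • V) z = h K z - s • V z := fun z => by
    simp only [h, ContinuousMap.sub_apply, ContinuousMap.smul_apply, add_sub_assoc]
  have hKsS : K.1 - s • V ∈ S := by
    obtain ⟨hK1, hK2⟩ := (hS K.1).1 K.2
    refine (hS _).2 ⟨fun τ => ?_, fun τ hτ t => ?_⟩
    · simp [hK1, hV0 (τ, 0)]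
    · have h1 := hVle (τ, t)
      rw [← hhs] at h1
      exact h1.trans (hK2 τ hτ t)
  have hΦs : Φ (K.1 - s • V) ≤ Φ K - ε * s := by
    refine ciSup_le fun τ => ?_
    rw [hhs]
    by_cases hz : Φ K - ε ≤ φ (h K (τ, 1))
    · exact (hVM (τ, 1) ⟨hz, rfl⟩).trans (by linarith [hle K τ])
    · have := hVle (τ, 1)
      nlinarith
  have hpos : 0 < ε * s := mul_pos hε hs0
  have hrel : rel K ⟨_, hKsS⟩ := by
    refine ⟨by change Φ (K.1 - s • V) ≤ Φ K; linarith, fun z => ?_⟩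
    change ‖(K.1 - s • V) z - K.1 z‖ ≤
      (1 + ‖h K z‖) * (Real.exp ((Φ K - Φ (K.1 - s • V)) / ε) - 1)
    have h1 : s ≤ (Φ K - Φ (K.1 - s • V)) / ε := (le_div_iff₀ hε).2 (by linarith)
    have h2 := Real.add_one_le_exp ((Φ K - Φ (K.1 - s • V)) / ε)
    have h3 : ‖(K.1 - s • V) z - K.1 z‖ = s * ‖V z‖ := by
      simp [norm_smul, abs_of_pos hs0]
    rw [h3, mul_comm]
    exact mul_le_mul (hV1 z) (by linarith) hs0.le (by positivity)
  have := hK _ hrel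
  simp only at this
  linarith

theorem exists_cerami_seq_of_minimax {T X : Type*} [TopologicalSpace T] [CompactSpace T]
    [T2Space T] [Nonempty T] [NormedAddCommGroup X] [InnerProductSpace ℝ X] [CompleteSpace X]
    {φ : X → ℝ} {φ' : X → X →L[ℝ] ℝ} (hφ : ∀ u, HasFDerivAt φ (φ' u) u)
    (hφw : ∀ (u : ℕ → X) (u₀ : X),
      (∀ v, Tendsto (fun n => ⟪u n, v⟫) atTop (𝓝 ⟪u₀, v⟫)) →
      ∀ v, Tendsto (fun n => φ' (u n) v) atTop (𝓝 (φ' u₀ v)))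
    (hφb : ∀ R, BddAbove (φ '' Metric.closedBall 0 R))
    {ι : T → X} (hι : ∀ v, Continuous fun τ => ⟪ι τ, v⟫) {r : ℝ} (hιr : ∀ τ, ‖ι τ‖ ≤ r)
    (husc : ∀ (K : C(T × unitInterval, X)) (b : ℝ), IsClosed {z | b ≤ φ (ι z.1 + K z)})
    {B : Set T} {b d κ : ℝ} (hB : ∀ τ ∈ B, φ (ι τ) ≤ b) (hd : ∀ τ, φ (ι τ) ≤ d)
    (hκ : ∀ K : C(T × unitInterval, X), (∀ τ, K (τ, 0) = 0) →
      (∀ τ ∈ B, ∀ t, φ (ι τ + K (τ, t)) ≤ b) → ∃ τ, κ ≤ φ (ι τ + K (τ, 1))) :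
    ∃ c, κ ≤ c ∧ c ≤ d ∧ ∃ u : ℕ → X, Tendsto (fun n => φ (u n)) atTop (𝓝 c) ∧
      Tendsto (fun n => ‖φ' (u n)‖ * (1 + ‖u n‖)) atTop (𝓝 0) := by
  let S : Set C(T × unitInterval, X) :=
    {K | (∀ τ, K (τ, 0) = 0) ∧ ∀ τ ∈ B, ∀ t, φ (ι τ + K (τ, t)) ≤ b}
  have hzero : (0 : C(T × unitInterval, X)) ∈ S :=
    ⟨fun _ => rfl, fun τ hτ t => by simpa using hB τ hτ⟩
  have : Nonempty S := ⟨⟨0, hzero⟩⟩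
  have hκΦ : ∀ K : S, κ ≤ ⨆ τ, φ (ι τ + K.1 (τ, 1)) := by
    intro K
    obtain ⟨τ, hτ⟩ := hκ K.1 K.2.1 K.2.2
    refine hτ.trans (le_ciSup (f := fun τ => φ (ι τ + K.1 (τ, 1)))
      ((hφb (r + ‖K.1‖)).mono ?_) τ)
    rintro _ ⟨τ, rfl⟩
    exact ⟨_, mem_closedBall_zero_iff.2 ((norm_add_le _ _).trans
      (add_le_add (hιr _) (K.1.norm_coe_le_norm _))), rfl⟩
  refine ⟨⨅ K : S, ⨆ τ, φ (ι τ + K.1 (τ, 1)), le_ciInf hκΦ, ?_, ?_⟩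
  · refine (ciInf_le ⟨κ, ?_⟩ ⟨0, hzero⟩).trans (ciSup_le fun τ => by simpa using hd τ)
    rintro _ ⟨K, rfl⟩
    exact hκΦ K
  · have hex := fun n : ℕ => exists_almost_critical_of_minimax hφ hφw hφb hι hιr husc (B := B)
      (b := b) (κ := κ) (S := S) (fun K => Iff.rfl) ⟨0, hzero⟩ (fun K hK => hκ K hK.1 hK.2)
      (ε := 1 / ((n : ℝ) + 1)) (by positivity)
    choose u hu1 hu2 using hex
    have hlim := tendsto_one_div_add_atTop_nhds_zero_nat (𝕜 := ℝ)
    refine ⟨u, ?_, ?_⟩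
    · rw [tendsto_iff_dist_tendsto_zero]
      exact squeeze_zero (fun _ => dist_nonneg) hu1 hlim
    · exact squeeze_zero (fun _ => by positivity) hu2 (by simpa using hlim.const_mul 2)

/-- A functional with weakly sequentially continuous derivative is bounded on balls. -/
theorem bddAbove_image_closedBall_of_weakSeqContinuous {X : Type*} [NormedAddCommGroup X]
    [InnerProductSpace ℝ X] [CompleteSpace X] {ψ : X → ℝ} {ψ' : X → X →L[ℝ] ℝ}
    (hψ : ∀ u, HasFDerivAt ψ (ψ' u) u)
    (hψw : ∀ (u : ℕ → X) (u₀ : X),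
      (∀ v, Tendsto (fun n => ⟪u n, v⟫) atTop (𝓝 ⟪u₀, v⟫)) →
      ∀ v, Tendsto (fun n => ψ' (u n) v) atTop (𝓝 (ψ' u₀ v))) (R : ℝ) :
    BddAbove (ψ '' Metric.closedBall 0 R) := by
  obtain ⟨T, _, _, _, ι, j, hιR, hι, -, hιj⟩ := exists_compact_weak_parametrization (∅ : Set X) R
  have hb : ∀ v, ∃ C, ∀ τ : T, ‖ψ' (ι τ) v‖ ≤ C := by
    intro v
    have hc : Continuous fun τ => ψ' (ι τ) v :=
      continuous_comp_of_weakSeqContinuous (f := fun u => ψ' u v) hι (fun τ => (hιR τ).1)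
        fun u u₀ hu => hψw u u₀ hu v
    obtain ⟨C, hC⟩ := isCompact_univ.exists_bound_of_continuousOn hc.continuousOn
    exact ⟨C, fun τ => hC τ trivial⟩
  obtain ⟨C, hC⟩ := banach_steinhaus hb
  have hC' : ∀ u ∈ Metric.closedBall (0 : X) R, ‖ψ' u‖ ≤ C := by
    intro u hu
    have := hC (j ⟨u, mem_closedBall_zero_iff.1 hu, by simp⟩)
    rwa [hιj] at this
  refine ⟨ψ 0 + C * R, ?_⟩
  rintro _ ⟨u, hu, rfl⟩
  have hR0 : 0 ≤ R := (norm_nonneg u).trans (mem_closedBall_zero_iff.1 hu)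
  have h1 := (convex_closedBall (0 : X) R).norm_image_sub_le_of_norm_hasFDerivWithin_le
    (fun x _ => (hψ x).hasFDerivWithinAt) hC' (Metric.mem_closedBall_self hR0) hu
  have hC0 : 0 ≤ C := (norm_nonneg _).trans (hC' u hu)
  have h2 := mul_le_mul_of_nonneg_left (mem_closedBall_zero_iff.1 hu) hC0
  rw [sub_zero] at h1
  linarith [le_abs_self (ψ u - ψ 0), Real.norm_eq_abs (ψ u - ψ 0)]

theorem kryszewskiSzulkin_linking
    {X : Type*} [NormedAddCommGroup X] [InnerProductSpace ℝ X] [CompleteSpace X]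
    -- `X = X⁻ ⊕ X⁺` with `X⁻ ⊥ X⁺`, and the associated projections
    (Xm Xp : Submodule ℝ X) (hXmc : IsClosed (Xm : Set X)) (hXpc : IsClosed (Xp : Set X))
    (hcompl : IsCompl Xm Xp)
    (horth : ∀ v ∈ Xm, ∀ w ∈ Xp, ⟪v, w⟫ = 0)
    (Pm Pp : X →L[ℝ] X)
    (hPm : ∀ u, Pm u ∈ Xm) (hPp : ∀ u, Pp u ∈ Xp) (hPsum : ∀ u, Pm u + Pp u = u)
    -- `φ(u) = ½(‖u⁺‖² - ‖u⁻‖²) - ψ(u)`, with `φ, ψ ∈ C¹(X, ℝ)`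
    (φ ψ : X → ℝ) (φ' ψ' : X → X →L[ℝ] ℝ)
    (hφ : ∀ u, φ u = (1/2) * (‖Pp u‖ ^ 2 - ‖Pm u‖ ^ 2) - ψ u)
    (hφ'd : ∀ u, HasFDerivAt φ (φ' u) u) (hφ'c : Continuous φ')
    (hψ'd : ∀ u, HasFDerivAt ψ (ψ' u) u) (hψ'c : Continuous ψ')
    -- (KS1): `ψ` is bounded below and weakly sequentially lower semicontinuous
    (hKS1a : BddBelow (Set.range ψ))
    (hKS1b : ∀ (u : ℕ → X) (u₀ : X),
      (∀ v, Tendsto (fun n => ⟪u n, v⟫) atTop (𝓝 ⟪u₀, v⟫)) →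
      ψ u₀ ≤ Filter.liminf (fun n => ψ (u n)) atTop)
    -- (KS2): `ψ'` is weakly sequentially continuous
    (hKS2 : ∀ (u : ℕ → X) (u₀ : X),
      (∀ v, Tendsto (fun n => ⟪u n, v⟫) atTop (𝓝 ⟪u₀, v⟫)) →
      ∀ v, Tendsto (fun n => ψ' (u n) v) atTop (𝓝 (ψ' u₀ v)))
    -- (KS3): `κ := inf φ(S⁺_ρ) > sup φ(∂Q)`
    (r ρ : ℝ) (hρ : 0 < ρ) (hρr : ρ < r) (e : X) (he : e ∈ Xp) (hen : ‖e‖ = 1)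
    (hKS3 : sSup (φ '' (Subtype.val '' frontier {w : ↥(Xm ⊔ Submodule.span ℝ {e}) |
        (∃ v ∈ Xm, ∃ s : ℝ, 0 ≤ s ∧ (w : X) = v + s • e) ∧ ‖(w : X)‖ ≤ r}))
      < sInf (φ '' {u : X | u ∈ Xp ∧ ‖u‖ = ρ})) :
    ∃ c : ℝ, sInf (φ '' {u : X | u ∈ Xp ∧ ‖u‖ = ρ}) ≤ c ∧
      c ≤ sSup (φ '' {u : X | (∃ v ∈ Xm, ∃ s : ℝ, 0 ≤ s ∧ u = v + s • e) ∧ ‖u‖ ≤ r}) ∧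
      ∃ u : ℕ → X, Tendsto (fun n => φ (u n)) atTop (𝓝 c) ∧
        Tendsto (fun n => ‖φ' (u n)‖ * (1 + ‖u n‖)) atTop (𝓝 0) := by
  have hPmp : ∀ u v, ⟪Pm u, Pp v⟫ = 0 := fun u v => horth _ (hPm u) _ (hPp v)
  have hPp_adj : ∀ u v, ⟪Pp u, Pp v⟫ = ⟪u, Pp v⟫ := fun u v => by
    conv_rhs => rw [← hPsum u]
    rw [inner_add_left, hPmp, zero_add]
  have hPm_adj : ∀ u v, ⟪Pm u, Pm v⟫ = ⟪u, Pm v⟫ := fun u v => by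
    conv_rhs => rw [← hPsum u]
    rw [inner_add_left, real_inner_comm _ (Pp u), hPmp, add_zero]
  have hPp_symm : ∀ u v, ⟪Pp u, v⟫ = ⟪u, Pp v⟫ := fun u v => by
    rw [real_inner_comm, ← hPp_adj, real_inner_comm, hPp_adj]
  obtain ⟨m, hm⟩ := hKS1a
  have hm : ∀ u, m ≤ ψ u := fun u => hm ⟨u, rfl⟩
  have hφw : ∀ (u : ℕ → X) (u₀ : X),
      (∀ v, Tendsto (fun n => ⟪u n, v⟫) atTop (𝓝 ⟪u₀, v⟫)) →
      ∀ v, Tendsto (fun n => φ' (u n) v) atTop (𝓝 (φ' u₀ v)) := by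
    have hφ' : ∀ u w, φ' u w = ⟪u, Pp w⟫ - ⟪u, Pm w⟫ - ψ' u w := by
      intro u w
      have h1 := ((((Pp.hasFDerivAt (x := u)).norm_sq.sub
        (Pm.hasFDerivAt (x := u)).norm_sq).const_mul (1 / 2)).sub (hψ'd u))
      have h2 := (hφ'd u).unique (h1.congr_of_eventuallyEq (Eventually.of_forall hφ))
      rw [h2]
      simp [hPp_adj, hPm_adj]
      ring
    intro u u₀ hu v
    simp_rw [hφ']
    exact ((hu _).sub (hu _)).sub (hKS2 u u₀ hu v)
  have hφb : ∀ R, BddAbove (φ '' Metric.closedBall 0 R) := by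
    intro R
    refine ⟨1 / 2 * (‖Pp‖ * R) ^ 2 - m, ?_⟩
    rintro _ ⟨u, hu, rfl⟩
    have h1 : ‖Pp u‖ ≤ ‖Pp‖ * R := (Pp.le_opNorm u).trans
      (mul_le_mul_of_nonneg_left (mem_closedBall_zero_iff.1 hu) (norm_nonneg _))
    have h2 := pow_le_pow_left₀ (norm_nonneg _) h1 2
    rw [hφ]
    linarith [sq_nonneg ‖Pm u‖, hm u]
  -- lower semicontinuity of the negative part of `φ`
  have hlsc : ∀ (y : ℝ) (u : ℕ → X) (u₀ : X),
      (∀ v, Tendsto (fun n => ⟪u n, v⟫) atTop (𝓝 ⟪u₀, v⟫)) →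
      (∀ n, 1 / 2 * ‖Pm (u n)‖ ^ 2 + ψ (u n) ≤ y) → 1 / 2 * ‖Pm u₀‖ ^ 2 + ψ u₀ ≤ y := by
    intro y u u₀ hu hy
    have h1 : ∀ n, ψ (u n) ≤ y - (⟪u n, Pm u₀⟫ - 1 / 2 * ‖Pm u₀‖ ^ 2) := by
      intro n
      have h2 := norm_sub_sq_real (Pm (u n)) (Pm u₀)
      rw [hPm_adj] at h2
      nlinarith [hy n, sq_nonneg ‖Pm (u n) - Pm u₀‖]
    have h3 : Tendsto (fun n => y - (⟪u n, Pm u₀⟫ - 1 / 2 * ‖Pm u₀‖ ^ 2)) atTop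
        (𝓝 (y - (⟪u₀, Pm u₀⟫ - 1 / 2 * ‖Pm u₀‖ ^ 2))) := ((hu _).sub_const _).const_sub _
    have h4 := (hKS1b u u₀ hu).trans (liminf_le_liminf (Eventually.of_forall h1)
      (isBoundedUnder_of ⟨m, fun n => hm _⟩) h3.isBoundedUnder_le.isCoboundedUnder_ge)
    rw [h3.liminf_eq, ← hPm_adj, real_inner_self_eq_norm_sq] at h4
    linarith
  have hPpp : ∀ u ∈ Xp, Pp u = u := by
    intro u hu
    have h1 : Pm u ∈ Xp := by
      rw [show Pm u = u - Pp u by rw [eq_sub_iff_add_eq, hPsum]]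
      exact Xp.sub_mem hu (hPp u)
    have h2 := (Submodule.disjoint_def.1 hcompl.disjoint) _ (hPm u) h1
    have := hPsum u
    rwa [h2, zero_add] at this
  have hPpm : ∀ u ∈ Xm, Pp u = 0 := by
    intro u hu
    have h1 : Pp u ∈ Xm := by
      rw [show Pp u = u - Pm u by rw [eq_sub_iff_add_eq', hPsum]]
      exact Xm.sub_mem hu (hPm u)
    exact (Submodule.disjoint_def.1 hcompl.disjoint) _ h1 (hPp u)
  have hee : ⟪e, e⟫ = 1 := by rw [real_inner_self_eq_norm_sq, hen]; norm_num
  -- `Q` is the intersection of a closed ball with a closed cone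
  let A : Set X := insert e (Set.range fun w => Pp w - ⟪e, w⟫ • e)
  have hA : ∀ u, (∀ a ∈ A, 0 ≤ ⟪u, a⟫) ↔ 0 ≤ ⟪u, e⟫ ∧ Pp u = ⟪u, e⟫ • e := by
    intro u
    have h1 : ∀ w, ⟪u, Pp w - ⟪e, w⟫ • e⟫ = ⟪Pp u - ⟪u, e⟫ • e, w⟫ := by
      intro w
      rw [inner_sub_right, inner_sub_left, inner_smul_right, real_inner_smul_left, hPp_symm]
      ring
    simp only [A, Set.forall_mem_insert, Set.forall_mem_range, h1]
    refine and_congr_right fun _ => ⟨fun h => ?_, fun h w => by simp [h]⟩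
    have h2 := h (-(Pp u - ⟪u, e⟫ • e))
    rw [inner_neg_right, real_inner_self_eq_norm_sq] at h2
    rw [← sub_eq_zero, ← norm_eq_zero]
    nlinarith [norm_nonneg (Pp u - ⟪u, e⟫ • e)]
  have hQA : ∀ u : X, (∃ v ∈ Xm, ∃ s : ℝ, 0 ≤ s ∧ u = v + s • e) ↔ ∀ a ∈ A, 0 ≤ ⟪u, a⟫ := by
    intro u
    rw [hA]
    constructor
    · rintro ⟨v, hv, s, hs, rfl⟩
      have h1 : ⟪v + s • e, e⟫ = s := by
        rw [inner_add_left, real_inner_smul_left, horth v hv e he, hee]; ring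
      rw [h1, map_add, map_smul, hPpm v hv, hPpp e he, zero_add]
      exact ⟨hs, rfl⟩
    · rintro ⟨h1, h2⟩
      exact ⟨Pm u, hPm u, _, h1, by rw [← h2, hPsum]⟩
  obtain ⟨T, _, _, _, ι, j, hιr, hι, hj, hιj⟩ := exists_compact_weak_parametrization A r
  have : Nonempty T := ⟨j ⟨0, by simpa using (hρ.trans hρr).le, by simp⟩⟩
  let Q : Set ↥(Xm ⊔ Submodule.span ℝ {e}) :=
    {w | (∃ v ∈ Xm, ∃ s : ℝ, 0 ≤ s ∧ (w : X) = v + s • e) ∧ ‖(w : X)‖ ≤ r}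
  let jQ : Q → T := fun w => j ⟨w, w.2.2, (hQA _).1 w.2.1⟩
  have hfrb : ∀ w ∈ frontier Q, ‖(w : X)‖ ≤ r := by
    intro w hw
    exact closure_minimal (t := {w : ↥(Xm ⊔ Submodule.span ℝ {e}) | ‖(w : X)‖ ≤ r})
      (fun w hw => hw.2) (isClosed_le (by fun_prop) (by fun_prop)) (frontier_subset_closure hw)
  have hbfr : BddAbove (φ '' (Subtype.val '' frontier Q)) := by
    refine (hφb r).mono (Set.image_mono ?_)
    rintro _ ⟨w, hw, rfl⟩
    exact mem_closedBall_zero_iff.2 (hfrb w hw)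
  have hbsph : BddBelow (φ '' {u : X | u ∈ Xp ∧ ‖u‖ = ρ}) := by
    obtain ⟨C, hC⟩ := bddAbove_image_closedBall_of_weakSeqContinuous hψ'd hKS2 ρ
    refine ⟨-C, ?_⟩
    rintro _ ⟨u, ⟨hu, hn⟩, rfl⟩
    have h1 : Pm u = 0 := by
      have := hPsum u
      rwa [hPpp u hu, add_eq_right] at this
    have h2 := hC ⟨u, mem_closedBall_zero_iff.2 hn.le, rfl⟩
    rw [hφ, h1, norm_zero]
    nlinarith [sq_nonneg ‖Pp u‖]
  refine exists_cerami_seq_of_minimax hφ'd hφw hφb hι (fun τ => (hιr τ).1) ?_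
    (B := {τ | ∃ w ∈ frontier Q, (w : X) = ι τ})
    (b := sSup (φ '' (Subtype.val '' frontier Q))) ?_ ?_ ?_
  · intro K b
    let h : T × unitInterval → X := fun z => ι z.1 + K z
    have hh : ∀ v, Continuous fun z => ⟪h z, v⟫ := fun v => by
      simp only [h, inner_add_left]
      exact ((hι v).comp continuous_fst).add (by fun_prop)
    have hR : ∀ z, ‖h z‖ ≤ r + ‖K‖ := fun z =>
      (norm_add_le _ _).trans (add_le_add (hιr _).1 (K.norm_coe_le_norm z))
    have h1 : Continuous fun z => Pp (h z) := by
      have h2 : ∀ z, Pp (h z) = ⟪ι z.1, e⟫ • e + Pp (K z) := fun z => by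
        rw [← ((hA _).1 (hιr z.1).2).2, ← map_add]
      simp_rw [h2]
      exact (((hι e).comp continuous_fst).smul continuous_const).add (by fun_prop)
    have h3 : LowerSemicontinuous fun z => 1 / 2 * ‖Pm (h z)‖ ^ 2 + ψ (h z) :=
      lowerSemicontinuous_iff_isClosed_preimage.2 fun y =>
        isClosed_preimage_of_weakSeqClosed (P := {u | 1 / 2 * ‖Pm u‖ ^ 2 + ψ u ≤ y}) hh hR
          (hlsc y)
    have h4 : Continuous fun z => -(1 / 2 * ‖Pp (h z)‖ ^ 2) :=
      ((h1.norm.pow 2).const_mul _).neg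
    convert (h3.add h4.lowerSemicontinuous).isClosed_preimage (-b) using 1
    ext z
    simp only [Set.mem_ofPred_eq, Set.mem_preimage, Set.mem_Iic, hφ]
    change b ≤ 1 / 2 * (‖Pp (h z)‖ ^ 2 - ‖Pm (h z)‖ ^ 2) - ψ (h z) ↔ _
    constructor <;> intro h5 <;> linarith
  · rintro τ ⟨w, hw, hwτ⟩
    exact le_csSup hbfr ⟨_, ⟨w, hw, rfl⟩, by rw [hwτ]⟩
  · intro τ
    refine le_csSup ((hφb r).mono (Set.image_mono fun u hu => mem_closedBall_zero_iff.2 hu.2))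
      ⟨_, ⟨(hQA _).2 (hιr τ).2, (hιr τ).1⟩, rfl⟩
  · intro K hK0 hKB
    have hιjQ : ∀ w : Q, ι (jQ w) = (w : X) := fun w => hιj _
    obtain ⟨w, hw⟩ := exists_mem_sphere_of_compact_homotopy Xm Xp hcompl Pm Pp hPm hPp hPsum r ρ
      hρ hρr e he hen (fun v hv => horth v hv e he) Q rfl ι hι jQ
      (hj.comp (by fun_prop)) hιjQ K K.continuous hK0 (by
        intro w hw t hmem
        have h1 := hKB (jQ w) ⟨w, hw, (hιjQ w).symm⟩ t
        rw [hιjQ] at h1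
        exact absurd (csInf_le hbsph ⟨_, hmem, rfl⟩) (not_le.2 (h1.trans_lt hKS3)))
    refine ⟨jQ w, ?_⟩
    rw [hιjQ]
    exact csInf_le hbsph ⟨_, hw, rfl⟩
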